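/- Let n ≥ 2 be an integer and i ∈ {1,2}. For every real x at which all rational functions appearing are defined, (x + γδ_{i,1}) 𝒟_i Q_n^{(i)}(x) = C_{1,n}(x) M_n(x) + D_{1,n}(x) M_{n−1}(x), where δ_{i,1} is the Kronecker delta. -/

import Mathlib

open Finset Filter Topology Polynomial

noncomputable section

/-- Pochhammer symbol `(a)_k = a(a+1)⋯(a+k−1)`. -/
def poch (a : ℝ) (k : ℕ) : ℝ := ∏ m ∈ Finset.range k, (a + m)

/-- Falling factorial `[x]_k = x(x−1)⋯(x−k+1)`. -/
def fall (x : ℝ) (k : ℕ) : ℝ := ∏ m ∈ Finset.range k, (x - m)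

/-- `⟨x⟩_i^k`: falling factorial for `i = 1`, Pochhammer symbol for `i = 2`. -/
def br (i : ℕ) (x : ℝ) (k : ℕ) : ℝ := if i = 1 then fall x k else poch x k

/-- Forward (`i = 1`) resp. backward (`i = 2`) difference operator `𝒟_i`. -/
def Dop (i : ℕ) (f : ℝ → ℝ) : ℝ → ℝ :=
  fun x => if i = 1 then f (x + 1) - f x else f x - f (x - 1)

/-- Iterated difference operator `𝒟_i^k`. -/
def Dk (i k : ℕ) (f : ℝ → ℝ) : ℝ → ℝ := (Dop i)^[k] f

/-- Kronecker delta `δ_{i,m}` (real valued). -/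
def kdelta (i m : ℕ) : ℝ := if i = m then 1 else 0

/-- The shift `x ± 1`: `x + 1` for `i = 1`, `x - 1` for `i = 2`. -/
def sh (i : ℕ) (x : ℝ) : ℝ := if i = 1 then x + 1 else x - 1

/-- Monic Meixner polynomial `M_n(x)`. -/
def MeixnerM (γ μ : ℝ) (n : ℕ) (x : ℝ) : ℝ :=
  poch γ n * (μ / (μ - 1)) ^ n *
    ∑ k ∈ Finset.range (n + 1),
      poch (-(n : ℝ)) k * poch (-x) k / poch γ k * (1 - μ⁻¹) ^ k / (Nat.factorial k : ℝ)

/-- Meixner inner product `⟨p,q⟩ = ∑_{x≥0} p(x)q(x) μ^x (γ)_x / x!`. -/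
def mIP (γ μ : ℝ) (p q : ℝ → ℝ) : ℝ :=
  ∑' x : ℕ, p x * q x * μ ^ x * poch γ x / (Nat.factorial x : ℝ)

/-- Squared Meixner norm `‖M_n‖²`. -/
def nrm2 (γ μ : ℝ) (n : ℕ) : ℝ := mIP γ μ (MeixnerM γ μ n) (MeixnerM γ μ n)

/-- Kernel `K_n^{(l,m)}(x,y)` for the operator `𝒟_i`. -/
def Klm (γ μ : ℝ) (i l m n : ℕ) (x y : ℝ) : ℝ :=
  ∑ k ∈ Finset.range (n + 1),
    Dk i l (MeixnerM γ μ k) x * Dk i m (MeixnerM γ μ k) y / nrm2 γ μ k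

/-- Sobolev inner product `⟨p,q⟩_λ = ⟨p,q⟩ + λ 𝒟_i^j p(α) 𝒟_i^j q(α)`. -/
def sIP (γ μ lam α : ℝ) (i j : ℕ) (p q : ℝ → ℝ) : ℝ :=
  mIP γ μ p q + lam * Dk i j p α * Dk i j q α

/-- `Q` is the monic Sobolev orthogonal polynomial of degree `n`. -/
def IsSobolevOP (γ μ lam α : ℝ) (i j n : ℕ) (Q : Polynomial ℝ) : Prop :=
  Q.Monic ∧ Q.natDegree = n ∧
    ∀ p : Polynomial ℝ, p.degree < (n : WithBot ℕ) →
      sIP γ μ lam α i j (fun x => Q.eval x) (fun x => p.eval x) = 0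

/-- Coefficient `a_n^{(k)}`. -/
def acoef (γ μ lam α : ℝ) (i j n k : ℕ) : ℝ :=
  -(lam * (Nat.factorial j : ℝ) * Dk i j (MeixnerM γ μ n) α * Dk i k (MeixnerM γ μ (n - 1)) α) /
    ((Nat.factorial k : ℝ) * nrm2 γ μ (n - 1) * (1 + lam * Klm γ μ i j j (n - 1) α α))

/-- Coefficient `b_n^{(k)}`. -/
def bcoef (γ μ lam α : ℝ) (i j n k : ℕ) : ℝ :=
  lam * (Nat.factorial j : ℝ) * Dk i j (MeixnerM γ μ n) α * Dk i k (MeixnerM γ μ n) α /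
    ((Nat.factorial k : ℝ) * nrm2 γ μ (n - 1) * (1 + lam * Klm γ μ i j j (n - 1) α α))

/-- Rational function `A_{1,n}(x)`. -/
def A1 (γ μ lam α : ℝ) (i j n : ℕ) (x : ℝ) : ℝ :=
  1 + (1 / br i (x - α) (j + 1)) *
    ∑ k ∈ Finset.range (j + 1), acoef γ μ lam α i j n k * br i (x - α) k

/-- Rational function `B_{1,n}(x)`. -/
def B1 (γ μ lam α : ℝ) (i j n : ℕ) (x : ℝ) : ℝ :=
  (1 / br i (x - α) (j + 1)) *
    ∑ k ∈ Finset.range (j + 1), bcoef γ μ lam α i j n k * br i (x - α) k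

/-- Meixner recurrence coefficient `α_n`. -/
def alphaR (γ μ : ℝ) (n : ℕ) : ℝ := ((n : ℝ) * (1 + μ) + μ * γ) / (1 - μ)

/-- Meixner recurrence coefficient `β_n`. -/
def betaR (γ μ : ℝ) (n : ℕ) : ℝ := (n : ℝ) * μ * ((n : ℝ) + γ - 1) / (1 - μ) ^ 2

/-- Rational function `A_{2,n}(x)`. -/
def A2 (γ μ lam α : ℝ) (i j n : ℕ) (x : ℝ) : ℝ :=
  -(B1 γ μ lam α i j (n - 1) x) / betaR γ μ (n - 1)

/-- Rational function `B_{2,n}(x)`. -/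
def B2 (γ μ lam α : ℝ) (i j n : ℕ) (x : ℝ) : ℝ :=
  A1 γ μ lam α i j (n - 1) x + A2 γ μ lam α i j n x * (alphaR γ μ (n - 1) - x)

/-- Rational function `C_{1,n}(x)`. -/
def C1 (γ μ lam α : ℝ) (i j n : ℕ) (x : ℝ) : ℝ :=
  (x + γ * kdelta i 1) * Dop i (A1 γ μ lam α i j n) x + (n : ℝ) * A1 γ μ lam α i j n (sh i x)
    - ((n : ℝ) - 1) * ((n : ℝ) + γ - 2) * μ ^ kdelta i 2 * B1 γ μ lam α i j n (sh i x) /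
        (betaR γ μ (n - 1) * (1 - μ))

/-- Rational function `D_{1,n}(x)`. -/
def D1 (γ μ lam α : ℝ) (i j n : ℕ) (x : ℝ) : ℝ :=
  (x + γ * kdelta i 1) * Dop i (B1 γ μ lam α i j n) x
    + ((n : ℝ) - 1) * B1 γ μ lam α i j n (sh i x)
    + ((n : ℝ) - 1) * ((n : ℝ) + γ - 2) * (x - alphaR γ μ (n - 1)) * μ ^ kdelta i 2 *
        B1 γ μ lam α i j n (sh i x) / (betaR γ μ (n - 1) * (1 - μ))
    + (n : ℝ) * ((n : ℝ) + γ - 1) * μ ^ kdelta i 2 * A1 γ μ lam α i j n (sh i x) / (1 - μ)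

/-- Rational function `C_{2,n}(x)`. -/
def C2 (γ μ lam α : ℝ) (i j n : ℕ) (x : ℝ) : ℝ :=
  -(D1 γ μ lam α i j (n - 1) x) / betaR γ μ (n - 1)

/-- Rational function `D_{2,n}(x)`. -/
def D2 (γ μ lam α : ℝ) (i j n : ℕ) (x : ℝ) : ℝ :=
  C1 γ μ lam α i j (n - 1) x + C2 γ μ lam α i j n x * (alphaR γ μ (n - 1) - x)

/-- `A_{m,n}(x)` for `m = 1, 2`. -/
def Aa (γ μ lam α : ℝ) (i j n m : ℕ) (x : ℝ) : ℝ :=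
  if m = 1 then A1 γ μ lam α i j n x else A2 γ μ lam α i j n x

/-- `B_{m,n}(x)` for `m = 1, 2`. -/
def Bb (γ μ lam α : ℝ) (i j n m : ℕ) (x : ℝ) : ℝ :=
  if m = 1 then B1 γ μ lam α i j n x else B2 γ μ lam α i j n x

/-- `C_{k,n}(x)` for `k = 1, 2`. -/
def Cc (γ μ lam α : ℝ) (i j n k : ℕ) (x : ℝ) : ℝ :=
  if k = 1 then C1 γ μ lam α i j n x else C2 γ μ lam α i j n x

/-- `D_{k,n}(x)` for `k = 1, 2`. -/
def Dd (γ μ lam α : ℝ) (i j n k : ℕ) (x : ℝ) : ℝ :=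
  if k = 1 then D1 γ μ lam α i j n x else D2 γ μ lam α i j n x

/-- `Λ_{m,n}^{(k)}(x) = (−1)^k (C_{k,n}(x) B_{m,n}(x) − A_{m,n}(x) D_{k,n}(x))`. -/
def Lam (γ μ lam α : ℝ) (i j n m k : ℕ) (x : ℝ) : ℝ :=
  (-1 : ℝ) ^ k * (Cc γ μ lam α i j n k x * Bb γ μ lam α i j n m x
    - Aa γ μ lam α i j n m x * Dd γ μ lam α i j n k x)

/-- `Θ_n(x) = A_{1,n}(x) B_{2,n}(x) − B_{1,n}(x) A_{2,n}(x)`. -/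
def Theta (γ μ lam α : ℝ) (i j n : ℕ) (x : ℝ) : ℝ :=
  A1 γ μ lam α i j n x * B2 γ μ lam α i j n x - B1 γ μ lam α i j n x * A2 γ μ lam α i j n x

/-- `Θ̃_n(x) = (x + γ δ_{i,1}) Θ_n(x)`. -/
def Thetatil (γ μ lam α : ℝ) (i j n : ℕ) (x : ℝ) : ℝ :=
  (x + γ * kdelta i 1) * Theta γ μ lam α i j n x

section Factorials

lemma poch_succ (a : ℝ) (k : ℕ) : poch a (k + 1) = poch a k * (a + k) :=
  Finset.prod_range_succ _ _

lemma fall_succ (x : ℝ) (k : ℕ) : fall x (k + 1) = fall x k * (x - k) :=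
  Finset.prod_range_succ _ _

@[simp] lemma poch_zero (a : ℝ) : poch a 0 = 1 := rfl

@[simp] lemma fall_zero (x : ℝ) : fall x 0 = 1 := rfl

lemma poch_pos {a : ℝ} (ha : 0 < a) (k : ℕ) : 0 < poch a k :=
  Finset.prod_pos fun _ _ => by positivity

lemma poch_neg (x : ℝ) (k : ℕ) : poch (-x) k = (-1) ^ k * fall x k := by
  induction k with
  | zero => simp
  | succ k ih => rw [poch_succ, fall_succ, ih]; ring

lemma fall_add_one_succ (x : ℝ) (k : ℕ) : fall (x + 1) (k + 1) = (x + 1) * fall x k := by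
  induction k with
  | zero => simp [fall_succ]
  | succ k ih => rw [fall_succ, ih, fall_succ]; push_cast; ring

lemma fall_natCast_eq_zero {n k : ℕ} (h : n < k) : fall n k = 0 :=
  Finset.prod_eq_zero (Finset.mem_range.2 h) (sub_self _)

lemma fall_natCast_self (n : ℕ) : fall n n = n.factorial := by
  induction n with
  | zero => simp
  | succ n ih => push_cast [fall_add_one_succ, ih, Nat.factorial_succ]; ring

lemma fall_eq_eval (x : ℝ) (k : ℕ) : fall x k = (descPochhammer ℝ k).eval x := by
  induction k with
  | zero => simp
  | succ k ih => rw [fall_succ, ih, descPochhammer_succ_right]; simp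

end Factorials

section Coefficients

/-- Coefficient of the falling factorial `[x]_k` in the monic Meixner polynomial of degree `n`. -/
def meixnerCoeff (γ μ : ℝ) (n k : ℕ) : ℝ :=
  poch γ n * (μ / (μ - 1)) ^ n * fall n k / (poch γ k * (μ / (μ - 1)) ^ k * k.factorial)

variable {γ μ : ℝ}

lemma meixnerCoeff_eq_zero {n k : ℕ} (h : n < k) : meixnerCoeff γ μ n k = 0 := by
  simp [meixnerCoeff, fall_natCast_eq_zero h]

lemma meixnerCoeff_self (hγ : 0 < γ) (hμ0 : 0 < μ) (hμ1 : μ < 1) (n : ℕ) :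
    meixnerCoeff γ μ n n = 1 := by
  have h1 := (poch_pos hγ n).ne'
  have h2 : μ / (μ - 1) ≠ 0 := div_ne_zero hμ0.ne' (by linarith)
  have h3 : (n.factorial : ℝ) ≠ 0 := by positivity
  rw [meixnerCoeff, fall_natCast_self, div_self]
  positivity

lemma sub_mul_meixnerCoeff_succ (n k : ℕ) :
    ((n : ℝ) + 1 - k) * meixnerCoeff γ μ (n + 1) k =
      (n + 1) * (γ + n) * (μ / (μ - 1)) * meixnerCoeff γ μ n k := by
  have h := (fall_succ ((n : ℝ) + 1) k).symm.trans (fall_add_one_succ n k)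
  simp only [meixnerCoeff, poch_succ, pow_succ, Nat.cast_add, Nat.cast_one]
  linear_combination (poch γ n * (γ + n) * ((μ / (μ - 1)) ^ n * (μ / (μ - 1))) /
    (poch γ k * (μ / (μ - 1)) ^ k * k.factorial)) * h

lemma mul_meixnerCoeff_succ_succ (hγ : 0 < γ) (hμ0 : 0 < μ) (hμ1 : μ < 1) (n k : ℕ) :
    ((k : ℝ) + 1) * (k + γ) * meixnerCoeff γ μ (n + 1) (k + 1) =
      (n + 1) * (γ + n) * meixnerCoeff γ μ n k := by
  have h1 := (poch_pos hγ k).ne'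
  have h2 : μ / (μ - 1) ≠ 0 := div_ne_zero hμ0.ne' (by linarith)
  have h3 : γ + k ≠ 0 := by positivity
  simp only [meixnerCoeff, poch_succ, pow_succ, Nat.cast_add, Nat.cast_one, fall_add_one_succ,
    Nat.factorial_succ, Nat.cast_mul]
  generalize μ / (μ - 1) = r at h2
  field_simp
  ring

lemma MeixnerM_eq_sum (hμ0 : 0 < μ) (hμ1 : μ < 1) (n : ℕ) (x : ℝ) :
    MeixnerM γ μ n x = ∑ k ∈ Finset.range (n + 1), meixnerCoeff γ μ n k * fall x k := by
  rw [MeixnerM, Finset.mul_sum]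
  refine Finset.sum_congr rfl fun k _ => ?_
  have h : 1 - μ⁻¹ = (μ / (μ - 1))⁻¹ := by
    have : μ - 1 ≠ 0 := by linarith
    field_simp
  have h1 : ((-1 : ℝ) ^ k) * (-1) ^ k = 1 := by rw [← mul_pow]; norm_num
  rw [meixnerCoeff, poch_neg, poch_neg, h, inv_pow]
  simp only [div_eq_mul_inv, mul_inv]
  linear_combination (poch γ n * (μ * (μ - 1)⁻¹) ^ n * fall n k * fall x k * (poch γ k)⁻¹ *
    ((μ * (μ - 1)⁻¹) ^ k)⁻¹ * (k.factorial : ℝ)⁻¹) * h1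

lemma MeixnerM_eq_sum_of_lt (hμ0 : 0 < μ) (hμ1 : μ < 1) {n N : ℕ} (h : n < N) (x : ℝ) :
    MeixnerM γ μ n x = ∑ k ∈ Finset.range N, meixnerCoeff γ μ n k * fall x k := by
  rw [MeixnerM_eq_sum hμ0 hμ1]
  refine Finset.sum_subset (Finset.range_mono h) fun k _ hk => ?_
  rw [meixnerCoeff_eq_zero (by rw [Finset.mem_range] at hk; omega), zero_mul]

end Coefficients

section StructureRelations

variable {γ μ : ℝ}

lemma mul_fall_sub_fall (x : ℝ) (k : ℕ) : x * (fall x k - fall (x - 1) k) = k * fall x k := by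
  have h := fall_add_one_succ (x - 1) k
  rw [sub_add_cancel, fall_succ] at h
  linear_combination h

lemma MeixnerM_backward (hμ0 : 0 < μ) (hμ1 : μ < 1) (n : ℕ) (x : ℝ) :
    x * (MeixnerM γ μ n x - MeixnerM γ μ n (x - 1)) =
      n * MeixnerM γ μ n x + μ * (n * (n + γ - 1) / (1 - μ)) * MeixnerM γ μ (n - 1) x := by
  cases n with
  | zero => simp [MeixnerM]
  | succ n =>
    rw [Nat.add_sub_cancel, MeixnerM_eq_sum hμ0 hμ1 (n + 1) x,
      MeixnerM_eq_sum hμ0 hμ1 (n + 1) (x - 1),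
      MeixnerM_eq_sum_of_lt hμ0 hμ1 (show n < n + 1 + 1 by omega), ← Finset.sum_sub_distrib,
      Finset.mul_sum, Finset.mul_sum, Finset.mul_sum, ← Finset.sum_add_distrib]
    refine Finset.sum_congr rfl fun k _ => ?_
    have h1 := mul_fall_sub_fall x k
    have h2 := sub_mul_meixnerCoeff_succ (γ := γ) (μ := μ) n k
    have h3 : μ / (μ - 1) = -(μ / (1 - μ)) := by rw [← neg_sub 1 μ, div_neg]
    rw [h3] at h2
    push_cast
    linear_combination meixnerCoeff γ μ (n + 1) k * h1 - fall x k * h2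

lemma add_mul_fall_sub_fall (x : ℝ) (k : ℕ) :
    (x + γ) * (fall (x + 1) (k + 1) - fall x (k + 1)) =
      (k + 1) * fall x (k + 1) + (k + 1) * (k + γ) * fall x k := by
  rw [fall_add_one_succ, fall_succ]
  ring

lemma MeixnerM_forward (hγ : 0 < γ) (hμ0 : 0 < μ) (hμ1 : μ < 1) (n : ℕ) (x : ℝ) :
    (x + γ) * (MeixnerM γ μ n (x + 1) - MeixnerM γ μ n x) =
      n * MeixnerM γ μ n x + (n * (n + γ - 1) / (1 - μ)) * MeixnerM γ μ (n - 1) x := by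
  cases n with
  | zero => simp [MeixnerM]
  | succ n =>
    have hb := MeixnerM_backward (γ := γ) hμ0 hμ1 (n + 1) x
    have hμ : (1 - μ) ≠ 0 := by linarith
    suffices (x + γ) * (MeixnerM γ μ (n + 1) (x + 1) - MeixnerM γ μ (n + 1) x) =
        x * (MeixnerM γ μ (n + 1) x - MeixnerM γ μ (n + 1) (x - 1)) +
          (n + 1) * (γ + n) * MeixnerM γ μ n x by
      rw [this, hb]
      push_cast [Nat.add_sub_cancel]
      field_simp
      ring
    have hx : x * (MeixnerM γ μ (n + 1) x - MeixnerM γ μ (n + 1) (x - 1)) =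
        ∑ k ∈ Finset.range (n + 1),
          meixnerCoeff γ μ (n + 1) (k + 1) * ((k + 1) * fall x (k + 1)) := by
      rw [MeixnerM_eq_sum hμ0 hμ1, MeixnerM_eq_sum hμ0 hμ1, ← Finset.sum_sub_distrib,
        Finset.mul_sum, Finset.sum_range_succ']
      simp only [fall_zero, sub_self, mul_zero, add_zero]
      refine Finset.sum_congr rfl fun k _ => ?_
      have h := mul_fall_sub_fall x (k + 1)
      push_cast at h
      linear_combination meixnerCoeff γ μ (n + 1) (k + 1) * h
    rw [hx, MeixnerM_eq_sum hμ0 hμ1, MeixnerM_eq_sum hμ0 hμ1, MeixnerM_eq_sum hμ0 hμ1,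
      ← Finset.sum_sub_distrib, Finset.mul_sum, Finset.mul_sum, ← Finset.sum_add_distrib,
      Finset.sum_range_succ']
    simp only [fall_zero, sub_self, mul_zero, add_zero]
    refine Finset.sum_congr rfl fun k _ => ?_
    linear_combination meixnerCoeff γ μ (n + 1) (k + 1) * add_mul_fall_sub_fall (γ := γ) x k +
      fall x k * mul_meixnerCoeff_succ_succ hγ hμ0 hμ1 n k

lemma MeixnerM_recurrence (hγ : 0 < γ) (hμ0 : 0 < μ) (hμ1 : μ < 1) (n : ℕ) (x : ℝ) :
    x * MeixnerM γ μ n x = MeixnerM γ μ (n + 1) x + alphaR γ μ n * MeixnerM γ μ n x +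
      betaR γ μ n * MeixnerM γ μ (n - 1) x := by
  have hμ : (1 - μ) ≠ 0 := by linarith
  have h1 := MeixnerM_forward hγ hμ0 hμ1 (n + 1) x
  have h2 := MeixnerM_backward (γ := γ) hμ0 hμ1 (n + 1) (x + 1)
  have h3 := MeixnerM_forward hγ hμ0 hμ1 n x
  rw [add_sub_cancel_right] at h2
  simp only [Nat.add_sub_cancel, Nat.cast_add, Nat.cast_one] at h1 h2
  generalize MeixnerM γ μ (n + 1) (x + 1) = a at *
  generalize MeixnerM γ μ (n + 1) x = b at *
  generalize MeixnerM γ μ n (x + 1) = c at *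
  generalize MeixnerM γ μ n x = d at *
  generalize MeixnerM γ μ (n - 1) x = e at *
  have hA : (1 - μ) * alphaR γ μ n = n * (1 + μ) + μ * γ := by
    rw [alphaR]
    field_simp
  have hB : (1 - μ) * betaR γ μ n = μ * (n * (n + γ - 1) / (1 - μ)) := by
    rw [betaR]
    field_simp
  have hC : ((n : ℝ) + 1) * (n + 1 + γ - 1) / (1 - μ) * (1 - μ) = (n + 1) * (n + γ) := by
    field_simp
    ring
  have hC0 : ((n : ℝ) + 1) * (n + 1 + γ - 1) / (1 - μ) ≠ 0 := by
    rw [show (n : ℝ) + 1 + γ - 1 = n + γ by ring]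
    positivity
  generalize ((n : ℝ) + 1) * (n + 1 + γ - 1) / (1 - μ) = c' at *
  generalize (n : ℝ) * (n + γ - 1) / (1 - μ) = p' at *
  refine mul_left_cancel₀ (mul_ne_zero hC0 hμ) ?_
  linear_combination (n - x) * h1 + (x + γ) * h2 + μ * c' * h3 - c' * d * hA - c' * e * hB -
    b * hC

end StructureRelations

section Weight

variable {γ μ : ℝ}

/-- The Meixner weight `μ^x (γ)_x / x!`. -/
def meixnerWeight (γ μ : ℝ) (x : ℕ) : ℝ := μ ^ x * poch γ x / x.factorial

lemma meixnerWeight_pos (hγ : 0 < γ) (hμ0 : 0 < μ) (x : ℕ) : 0 < meixnerWeight γ μ x := by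
  have := poch_pos hγ x
  unfold meixnerWeight
  positivity

lemma meixnerWeight_succ (x : ℕ) :
    ((x : ℝ) + 1) * meixnerWeight γ μ (x + 1) = μ * (x + γ) * meixnerWeight γ μ x := by
  simp only [meixnerWeight, poch_succ, pow_succ, Nat.factorial_succ, Nat.cast_mul, Nat.cast_add,
    Nat.cast_one]
  field_simp
  ring

lemma summable_pow_mul_meixnerWeight (hγ : 0 < γ) (hμ0 : 0 < μ) (hμ1 : μ < 1) (m : ℕ) :
    Summable fun x : ℕ => (x : ℝ) ^ m * meixnerWeight γ μ x := by
  refine summable_of_ratio_test_tendsto_lt_one hμ1 ?_ ?_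
  · filter_upwards [eventually_gt_atTop 0] with x hx
    have := meixnerWeight_pos (μ := μ) hγ hμ0 x
    positivity
  · have hinv : Tendsto (fun x : ℕ => (x : ℝ)⁻¹) atTop (𝓝 0) :=
      tendsto_inv_atTop_nhds_zero_nat
    have h1 : Tendsto (fun x : ℕ => (1 + (x : ℝ)⁻¹) ^ m * (μ * (1 + γ * (x : ℝ)⁻¹) /
        (1 + (x : ℝ)⁻¹))) atTop (𝓝 ((1 + 0) ^ m * (μ * (1 + γ * 0) / (1 + 0)))) :=
      ((hinv.const_add 1).pow m).mul ((((hinv.const_mul γ).const_add 1).const_mul μ).div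
        (hinv.const_add 1) (by norm_num))
    rw [show (1 + 0 : ℝ) ^ m * (μ * (1 + γ * 0) / (1 + 0)) = μ by simp] at h1
    refine h1.congr' ?_
    filter_upwards [eventually_gt_atTop 0] with x hx
    have hw := meixnerWeight_pos (μ := μ) hγ hμ0 x
    have hw' := meixnerWeight_pos (μ := μ) hγ hμ0 (x + 1)
    have hx' : (0 : ℝ) < x := by exact_mod_cast hx
    rw [Real.norm_of_nonneg (by positivity), Real.norm_of_nonneg (by positivity),
      show meixnerWeight γ μ (x + 1) = μ * (x + γ) * meixnerWeight γ μ x / (x + 1) by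
        rw [← meixnerWeight_succ]; field_simp]
    rw [show 1 + (x : ℝ)⁻¹ = (x + 1) / x by field_simp, div_pow]
    push_cast
    field_simp

lemma summable_eval_mul_meixnerWeight (hγ : 0 < γ) (hμ0 : 0 < μ) (hμ1 : μ < 1) (p : ℝ[X]) :
    Summable fun x : ℕ => p.eval (x : ℝ) * meixnerWeight γ μ x := by
  simp only [Polynomial.eval_eq_sum_range, Finset.sum_mul, mul_assoc]
  exact summable_sum fun k _ => (summable_pow_mul_meixnerWeight hγ hμ0 hμ1 k).mul_left _

/-- The Meixner moment functional `p ↦ ∑_{x ≥ 0} p(x) μ^x (γ)_x / x!`. -/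
def meixnerFunctional (hγ : 0 < γ) (hμ0 : 0 < μ) (hμ1 : μ < 1) : ℝ[X] →ₗ[ℝ] ℝ where
  toFun p := ∑' x : ℕ, p.eval (x : ℝ) * meixnerWeight γ μ x
  map_add' p q := by
    simp only [Polynomial.eval_add, add_mul]
    exact (summable_eval_mul_meixnerWeight hγ hμ0 hμ1 p).tsum_add
      (summable_eval_mul_meixnerWeight hγ hμ0 hμ1 q)
  map_smul' c p := by
    simp only [Polynomial.eval_smul, smul_eq_mul, mul_assoc, tsum_mul_left, RingHom.id_apply]

lemma mIP_eq_meixnerFunctional (hγ : 0 < γ) (hμ0 : 0 < μ) (hμ1 : μ < 1) (p q : ℝ[X]) :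
    mIP γ μ (fun x => p.eval x) (fun x => q.eval x) = meixnerFunctional hγ hμ0 hμ1 (p * q) := by
  refine tsum_congr fun x => ?_
  simp only [meixnerWeight, Polynomial.eval_mul]
  ring

lemma meixnerFunctional_pearson (hγ : 0 < γ) (hμ0 : 0 < μ) (hμ1 : μ < 1) (p : ℝ[X]) :
    meixnerFunctional hγ hμ0 hμ1 (X * p) =
      meixnerFunctional hγ hμ0 hμ1 (C μ * (X + C γ) * p.comp (X + 1)) := by
  refine ((summable_eval_mul_meixnerWeight hγ hμ0 hμ1 _).tsum_eq_zero_add).trans ?_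
  simp only [Polynomial.eval_mul, Polynomial.eval_X, Nat.cast_zero, zero_mul, zero_add]
  refine tsum_congr fun x => ?_
  have h := meixnerWeight_succ (γ := γ) (μ := μ) x
  simp only [Polynomial.eval_mul, Polynomial.eval_X, Polynomial.eval_C, Polynomial.eval_add,
    Polynomial.eval_comp, Polynomial.eval_one, Nat.cast_add, Nat.cast_one]
  linear_combination p.eval ((x : ℝ) + 1) * h

end Weight

section Orthogonality

variable {γ μ : ℝ}

/-- The monic Meixner polynomial as a polynomial. -/
def meixnerPoly (γ μ : ℝ) (n : ℕ) : ℝ[X] :=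
  ∑ k ∈ Finset.range (n + 1), C (meixnerCoeff γ μ n k) * descPochhammer ℝ k

lemma eval_meixnerPoly (hμ0 : 0 < μ) (hμ1 : μ < 1) (n : ℕ) (x : ℝ) :
    (meixnerPoly γ μ n).eval x = MeixnerM γ μ n x := by
  rw [MeixnerM_eq_sum hμ0 hμ1, meixnerPoly, Polynomial.eval_finsetSum]
  simp only [Polynomial.eval_mul, Polynomial.eval_C, fall_eq_eval]

lemma degree_meixnerPoly_sub_lt (hγ : 0 < γ) (hμ0 : 0 < μ) (hμ1 : μ < 1) (n : ℕ) :
    (meixnerPoly γ μ n - descPochhammer ℝ n).degree < n := by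
  rw [meixnerPoly, Finset.sum_range_succ, meixnerCoeff_self hγ hμ0 hμ1, map_one, one_mul,
    add_sub_cancel_right]
  refine (Polynomial.degree_sum_le _ _).trans_lt
    ((Finset.sup_lt_iff (WithBot.bot_lt_coe n)).2 fun k hk => ?_)
  rw [← Polynomial.smul_eq_C_mul]
  refine (Polynomial.degree_smul_le _ _).trans_lt ?_
  refine Polynomial.degree_le_natDegree.trans_lt ?_
  rw [descPochhammer_natDegree]
  exact WithBot.coe_lt_coe.2 (Finset.mem_range.1 hk)

lemma natDegree_monic_meixnerPoly (hγ : 0 < γ) (hμ0 : 0 < μ) (hμ1 : μ < 1) (n : ℕ) :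
    (meixnerPoly γ μ n).natDegree = n ∧ (meixnerPoly γ μ n).Monic := by
  have hm := monic_descPochhammer ℝ n
  have hd : (descPochhammer ℝ n).degree = n := by
    rw [Polynomial.degree_eq_natDegree hm.ne_zero, descPochhammer_natDegree]
  have hlt : (meixnerPoly γ μ n - descPochhammer ℝ n).degree < (descPochhammer ℝ n).degree :=
    hd ▸ degree_meixnerPoly_sub_lt hγ hμ0 hμ1 n
  rw [← add_sub_cancel (descPochhammer ℝ n) (meixnerPoly γ μ n)]
  refine ⟨?_, hm.add_of_left hlt⟩
  rw [Polynomial.natDegree_eq_of_degree_eq (Polynomial.degree_add_eq_left_of_degree_lt hlt),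
    descPochhammer_natDegree]

/-- The second order difference operator of which the Meixner polynomials are eigenfunctions. -/
def meixnerOperator (γ μ : ℝ) (f : ℝ[X]) : ℝ[X] :=
  C μ * (X + C γ) * (f.comp (X + 1) - f) - X * (f - f.comp (X - 1))

lemma meixnerOperator_meixnerPoly (hγ : 0 < γ) (hμ0 : 0 < μ) (hμ1 : μ < 1) (n : ℕ) :
    meixnerOperator γ μ (meixnerPoly γ μ n) = ((n : ℝ) * (μ - 1)) • meixnerPoly γ μ n := by
  refine Polynomial.funext fun x => ?_
  have h1 := MeixnerM_forward hγ hμ0 hμ1 n x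
  have h2 := MeixnerM_backward (γ := γ) hμ0 hμ1 n x
  simp only [meixnerOperator, Polynomial.eval_mul, Polynomial.eval_X, Polynomial.eval_C,
    Polynomial.eval_add, Polynomial.eval_sub, Polynomial.eval_comp, Polynomial.eval_one,
    Polynomial.eval_smul, eval_meixnerPoly hμ0 hμ1, smul_eq_mul]
  linear_combination μ * h1 - h2

lemma meixnerFunctional_operator_comm (hγ : 0 < γ) (hμ0 : 0 < μ) (hμ1 : μ < 1) (f g : ℝ[X]) :
    meixnerFunctional hγ hμ0 hμ1 (meixnerOperator γ μ f * g) =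
      meixnerFunctional hγ hμ0 hμ1 (f * meixnerOperator γ μ g) := by
  have hc (p : ℝ[X]) : (p.comp (X - 1)).comp (X + 1) = p := by
    rw [Polynomial.comp_assoc]
    simp
  have h1 := meixnerFunctional_pearson hγ hμ0 hμ1 (f.comp (X - 1) * g)
  have h2 := meixnerFunctional_pearson hγ hμ0 hμ1 (f * g.comp (X - 1))
  rw [Polynomial.mul_comp, hc] at h1 h2
  rw [← sub_eq_zero] at h1 h2 ⊢
  rw [← map_sub] at h1 h2 ⊢
  have h3 : meixnerOperator γ μ f * g - f * meixnerOperator γ μ g =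
      (X * (f.comp (X - 1) * g) - C μ * (X + C γ) * (f * g.comp (X + 1))) -
      (X * (f * g.comp (X - 1)) - C μ * (X + C γ) * (f.comp (X + 1) * g)) := by
    simp only [meixnerOperator]
    ring
  rw [h3, map_sub, h1, h2, sub_zero]

lemma meixnerFunctional_mul_of_ne (hγ : 0 < γ) (hμ0 : 0 < μ) (hμ1 : μ < 1) {m n : ℕ}
    (h : m ≠ n) :
    meixnerFunctional hγ hμ0 hμ1 (meixnerPoly γ μ m * meixnerPoly γ μ n) = 0 := by
  have h1 := meixnerFunctional_operator_comm hγ hμ0 hμ1 (meixnerPoly γ μ m) (meixnerPoly γ μ n)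
  rw [meixnerOperator_meixnerPoly hγ hμ0 hμ1, meixnerOperator_meixnerPoly hγ hμ0 hμ1,
    smul_mul_assoc, mul_smul_comm, map_smul, map_smul, smul_eq_mul, smul_eq_mul] at h1
  have h2 : ((m : ℝ) - n) * (μ - 1) ≠ 0 :=
    mul_ne_zero (sub_ne_zero.2 (by exact_mod_cast h)) (by linarith)
  refine (mul_eq_zero.1 ?_).resolve_left h2
  linear_combination h1

lemma nrm2_eq (hγ : 0 < γ) (hμ0 : 0 < μ) (hμ1 : μ < 1) (n : ℕ) :
    nrm2 γ μ n = meixnerFunctional hγ hμ0 hμ1 (meixnerPoly γ μ n * meixnerPoly γ μ n) := by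
  rw [← mIP_eq_meixnerFunctional]
  simp only [eval_meixnerPoly hμ0 hμ1]
  rfl

lemma X_mul_meixnerPoly (hγ : 0 < γ) (hμ0 : 0 < μ) (hμ1 : μ < 1) (n : ℕ) :
    X * meixnerPoly γ μ n = meixnerPoly γ μ (n + 1) + alphaR γ μ n • meixnerPoly γ μ n +
      betaR γ μ n • meixnerPoly γ μ (n - 1) := by
  refine Polynomial.funext fun x => ?_
  simp only [Polynomial.eval_mul, Polynomial.eval_X, Polynomial.eval_add, Polynomial.eval_smul,
    eval_meixnerPoly hμ0 hμ1, smul_eq_mul]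
  exact MeixnerM_recurrence hγ hμ0 hμ1 n x

lemma betaR_succ_pos (hγ : 0 < γ) (hμ0 : 0 < μ) (hμ1 : μ < 1) (n : ℕ) :
    0 < betaR γ μ (n + 1) := by
  have h : 0 < 1 - μ := by linarith
  rw [betaR, show ((n + 1 : ℕ) : ℝ) + γ - 1 = n + γ by push_cast; ring]
  positivity

lemma nrm2_succ (hγ : 0 < γ) (hμ0 : 0 < μ) (hμ1 : μ < 1) (n : ℕ) :
    nrm2 γ μ (n + 1) = betaR γ μ (n + 1) * nrm2 γ μ n := by
  set L := meixnerFunctional hγ hμ0 hμ1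
  have h1 : L ((X * meixnerPoly γ μ n) * meixnerPoly γ μ (n + 1)) = nrm2 γ μ (n + 1) := by
    have hz : betaR γ μ n * L (meixnerPoly γ μ (n - 1) * meixnerPoly γ μ (n + 1)) = 0 := by
      rw [meixnerFunctional_mul_of_ne hγ hμ0 hμ1 (by omega), mul_zero]
    simp only [X_mul_meixnerPoly hγ hμ0 hμ1, add_mul, smul_mul_assoc, map_add, map_smul,
      smul_eq_mul, hz, nrm2_eq hγ hμ0 hμ1]
    rw [meixnerFunctional_mul_of_ne hγ hμ0 hμ1 (show n ≠ n + 1 by omega)]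
    ring
  have h2 : L (meixnerPoly γ μ n * (X * meixnerPoly γ μ (n + 1))) =
      betaR γ μ (n + 1) * nrm2 γ μ n := by
    simp only [X_mul_meixnerPoly hγ hμ0 hμ1, mul_add, mul_smul_comm, map_add, map_smul,
      smul_eq_mul, nrm2_eq hγ hμ0 hμ1, Nat.add_sub_cancel]
    rw [meixnerFunctional_mul_of_ne hγ hμ0 hμ1 (show n ≠ n + 1 by omega),
      meixnerFunctional_mul_of_ne hγ hμ0 hμ1 (show n ≠ n + 1 + 1 by omega)]
    ring
  rw [← h1, ← h2]
  congr 1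
  ring

lemma nrm2_pos (hγ : 0 < γ) (hμ0 : 0 < μ) (hμ1 : μ < 1) (n : ℕ) : 0 < nrm2 γ μ n := by
  induction n with
  | zero =>
    rw [nrm2_eq hγ hμ0 hμ1]
    have h1 : meixnerPoly γ μ 0 = 1 := by
      simp [meixnerPoly, meixnerCoeff_self hγ hμ0 hμ1]
    rw [h1, mul_one]
    exact (summable_eval_mul_meixnerWeight hγ hμ0 hμ1 1).tsum_pos
      (fun x => by simpa using (meixnerWeight_pos hγ hμ0 x).le) 0
      (by simpa using meixnerWeight_pos hγ hμ0 0)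
  | succ n ih =>
    rw [nrm2_succ hγ hμ0 hμ1]
    exact mul_pos (betaR_succ_pos hγ hμ0 hμ1 n) ih

lemma exists_eq_sum_meixnerPoly (hγ : 0 < γ) (hμ0 : 0 < μ) (hμ1 : μ < 1) (n : ℕ) (p : ℝ[X])
    (hp : p.degree < n) :
    ∃ c : ℕ → ℝ, p = ∑ k ∈ Finset.range n, c k • meixnerPoly γ μ k := by
  induction n generalizing p with
  | zero => exact ⟨0, by simpa using hp⟩
  | succ n ih =>
    obtain ⟨hd, hm⟩ := natDegree_monic_meixnerPoly hγ hμ0 hμ1 n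
    have hlt : (p - p.coeff n • meixnerPoly γ μ n).degree < n := by
      rw [Polynomial.degree_lt_iff_coeff_zero] at hp ⊢
      intro m hnm
      rw [Polynomial.coeff_sub, Polynomial.coeff_smul, smul_eq_mul]
      rcases hnm.eq_or_lt with rfl | hlt
      · have := hm.coeff_natDegree
        rw [hd] at this
        rw [this, mul_one, sub_self]
      · rw [hp m hlt, Polynomial.coeff_eq_zero_of_natDegree_lt (hd.trans_lt hlt), mul_zero,
          sub_zero]
    obtain ⟨c, hc⟩ := ih _ hlt
    refine ⟨Function.update c n (p.coeff n), ?_⟩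
    rw [Finset.sum_range_succ, Function.update_self, ← sub_eq_iff_eq_add, hc]
    refine Finset.sum_congr rfl fun k hk => ?_
    rw [Function.update_of_ne (Finset.mem_range.1 hk).ne]

end Orthogonality

section Differences

/-- The difference operator `𝒟_i` as a linear map. -/
def dopLinear (i : ℕ) : (ℝ → ℝ) →ₗ[ℝ] (ℝ → ℝ) where
  toFun := Dop i
  map_add' f g := by
    funext x
    simp only [Dop, Pi.add_apply]
    split_ifs <;> ring
  map_smul' c f := by
    funext x
    simp only [Dop, Pi.smul_apply, smul_eq_mul, RingHom.id_apply]
    split_ifs <;> ring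

lemma Dk_eq_pow (i k : ℕ) (f : ℝ → ℝ) : Dk i k f = (dopLinear i ^ k) f :=
  (Module.End.pow_apply (dopLinear i) k f).symm

lemma Dk_sub (i k : ℕ) (f g : ℝ → ℝ) : Dk i k (f - g) = Dk i k f - Dk i k g := by
  simp only [Dk_eq_pow, map_sub]

lemma Dk_smul (i k : ℕ) (c : ℝ) (f : ℝ → ℝ) : Dk i k (c • f) = c • Dk i k f := by
  simp only [Dk_eq_pow, map_smul]

lemma Dk_sum_smul (i k n : ℕ) (c : ℕ → ℝ) (f : ℕ → ℝ → ℝ) :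
    Dk i k (∑ l ∈ Finset.range n, c l • f l) = ∑ l ∈ Finset.range n, c l • Dk i k (f l) := by
  simp only [Dk_eq_pow, map_sum, map_smul]

lemma Dk_succ (i k : ℕ) (f : ℝ → ℝ) (y : ℝ) : Dk i (k + 1) f y = Dop i (Dk i k f) y :=
  congrFun (Function.iterate_succ_apply' (Dop i) k f) y

/-- The signed step `1` for the forward and `-1` for the backward difference operator. -/
def dstep (i : ℕ) : ℝ := if i = 1 then 1 else -1

lemma br_succ (i : ℕ) (x : ℝ) (k : ℕ) : br i x (k + 1) = br i x k * (x - dstep i * k) := by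
  unfold br dstep
  split_ifs
  · rw [fall_succ, one_mul]
  · rw [poch_succ]
    ring

lemma Dop_sub_mul (i : ℕ) (c : ℝ) (g : ℝ → ℝ) (y : ℝ) :
    Dop i (fun t => (c - t) * g t) y = (c - y - dstep i) * Dop i g y - g y := by
  unfold Dop dstep
  split_ifs <;> ring

lemma Dk_sub_mul (i k : ℕ) (x : ℝ) (g : ℝ → ℝ) (y : ℝ) :
    Dk i k (fun t => (x - t) * g t) y =
      (x - y - dstep i * k) * Dk i k g y - k * Dk i (k - 1) g y := by
  induction k generalizing y with
  | zero => simp [Dk]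
  | succ k ih =>
    have hF : Dk i k (fun t => (x - t) * g t) =
        (fun t => (x - dstep i * k - t) * Dk i k g t) - (k : ℝ) • Dk i (k - 1) g := by
      funext t
      rw [ih]
      simp only [Pi.sub_apply, Pi.smul_apply, smul_eq_mul]
      ring
    have hk : (k : ℝ) * Dop i (Dk i (k - 1) g) y = k * Dk i k g y := by
      cases k with
      | zero => simp
      | succ k => rw [Dk_succ i k, Nat.add_sub_cancel]
    have hlin : Dop i ((fun t => (x - dstep i * k - t) * Dk i k g t) - (k : ℝ) • Dk i (k - 1) g) y =
        Dop i (fun t => (x - dstep i * k - t) * Dk i k g t) y -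
          k * Dop i (Dk i (k - 1) g) y := by
      change dopLinear i _ y = _
      rw [map_sub, map_smul]
      rfl
    rw [Dk_succ, hF, hlin, Dop_sub_mul, hk, Dk_succ, Nat.add_sub_cancel]
    push_cast
    ring

lemma sum_Dk_sub_mul (i j : ℕ) (x α : ℝ) (g : ℝ → ℝ) :
    ∑ k ∈ Finset.range (j + 1), Dk i k (fun t => (x - t) * g t) α * br i (x - α) k / k.factorial =
      br i (x - α) (j + 1) * Dk i j g α / j.factorial := by
  induction j with
  | zero => rw [Finset.sum_range_one, Dk_sub_mul, br_succ]; simp; ring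
  | succ j ih =>
    rw [Finset.sum_range_succ, ih, Dk_sub_mul, br_succ i (x - α) (j + 1), Nat.add_sub_cancel,
      Nat.factorial_succ]
    push_cast
    field_simp
    ring

end Differences

section Sobolev

variable {γ μ lam α : ℝ} {i j : ℕ}

lemma christoffel_darboux (hγ : 0 < γ) (hμ0 : 0 < μ) (hμ1 : μ < 1) (n : ℕ) (x y : ℝ) :
    (x - y) * ∑ k ∈ Finset.range (n + 1), MeixnerM γ μ k x / nrm2 γ μ k * MeixnerM γ μ k y =
      (MeixnerM γ μ (n + 1) x * MeixnerM γ μ n y - MeixnerM γ μ n x * MeixnerM γ μ (n + 1) y) /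
        nrm2 γ μ n := by
  induction n with
  | zero =>
    have h1 := MeixnerM_recurrence hγ hμ0 hμ1 0 x
    have h2 := MeixnerM_recurrence hγ hμ0 hμ1 0 y
    have hb : betaR γ μ 0 = 0 := by simp [betaR]
    rw [hb] at h1 h2
    rw [Finset.sum_range_one]
    linear_combination MeixnerM γ μ 0 y / nrm2 γ μ 0 * h1 - MeixnerM γ μ 0 x / nrm2 γ μ 0 * h2
  | succ n ih =>
    have h1 := MeixnerM_recurrence hγ hμ0 hμ1 (n + 1) x
    have h2 := MeixnerM_recurrence hγ hμ0 hμ1 (n + 1) y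
    have hβ := (betaR_succ_pos hγ hμ0 hμ1 n).ne'
    have hN := (nrm2_pos hγ hμ0 hμ1 n).ne'
    rw [Nat.add_sub_cancel] at h1 h2
    rw [Finset.sum_range_succ, mul_add, ih, nrm2_succ hγ hμ0 hμ1]
    field_simp
    linear_combination MeixnerM γ μ (n + 1) y * h1 - MeixnerM γ μ (n + 1) x * h2

lemma one_add_mul_Klm_pos (hγ : 0 < γ) (hμ0 : 0 < μ) (hμ1 : μ < 1) (hlam : 0 < lam) (n : ℕ) :
    0 < 1 + lam * Klm γ μ i j j n α α := by
  have h : 0 ≤ Klm γ μ i j j n α α := Finset.sum_nonneg fun k _ =>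
    div_nonneg (mul_self_nonneg _) (nrm2_pos hγ hμ0 hμ1 k).le
  positivity

lemma IsSobolevOP.eval_eq (hγ : 0 < γ) (hμ0 : 0 < μ) (hμ1 : μ < 1) {n : ℕ} {Q : ℝ[X]}
    (hQ : IsSobolevOP γ μ lam α i j n Q) :
    (fun t => Q.eval t) = MeixnerM γ μ n - (lam * Dk i j (fun t => Q.eval t) α) •
      ∑ k ∈ Finset.range n, (Dk i j (MeixnerM γ μ k) α / nrm2 γ μ k) • MeixnerM γ μ k := by
  obtain ⟨hmonic, hdeg, horth⟩ := hQ
  obtain ⟨hd, hm⟩ := natDegree_monic_meixnerPoly hγ hμ0 hμ1 n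
  have hQd : Q.degree = n := by rw [Polynomial.degree_eq_natDegree hmonic.ne_zero, hdeg]
  have hPd : (meixnerPoly γ μ n).degree = n := by
    rw [Polynomial.degree_eq_natDegree hm.ne_zero, hd]
  have hlt : (Q - meixnerPoly γ μ n).degree < n := hQd ▸ Polynomial.degree_sub_lt_left
    (hQd.trans hPd.symm) hmonic.ne_zero (by rw [hmonic.leadingCoeff, hm.leadingCoeff])
  obtain ⟨c, hc⟩ := exists_eq_sum_meixnerPoly hγ hμ0 hμ1 n _ hlt
  have hck : ∀ k ∈ Finset.range n,
      c k = -(lam * Dk i j (fun t => Q.eval t) α * (Dk i j (MeixnerM γ μ k) α / nrm2 γ μ k)) := by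
    intro k hk
    have hN := (nrm2_pos hγ hμ0 hμ1 k).ne'
    obtain ⟨hkd, hkm⟩ := natDegree_monic_meixnerPoly hγ hμ0 hμ1 k
    have h := horth (meixnerPoly γ μ k) (by
      rw [Polynomial.degree_eq_natDegree hkm.ne_zero, hkd]
      exact_mod_cast Finset.mem_range.1 hk)
    rw [sIP, mIP_eq_meixnerFunctional hγ hμ0 hμ1, sub_eq_iff_eq_add.1 hc, add_mul, map_add,
      meixnerFunctional_mul_of_ne hγ hμ0 hμ1 (Finset.mem_range.1 hk).ne', add_zero,
      Finset.sum_mul, map_sum, Finset.sum_eq_single_of_mem k hk, smul_mul_assoc, map_smul,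
      smul_eq_mul, ← nrm2_eq, ← sub_eq_iff_eq_add.1 hc] at h
    · simp only [eval_meixnerPoly hμ0 hμ1] at h
      field_simp
      linear_combination h
    · intro l _ hl
      rw [smul_mul_assoc, map_smul, meixnerFunctional_mul_of_ne hγ hμ0 hμ1 hl, smul_zero]
  funext x
  have hx := congrArg (Polynomial.eval x) hc
  rw [Polynomial.eval_sub, Polynomial.eval_finsetSum, eval_meixnerPoly hμ0 hμ1,
    Finset.sum_congr rfl fun k hk => by rw [hck k hk]] at hx
  simp only [Polynomial.eval_smul, eval_meixnerPoly hμ0 hμ1, smul_eq_mul, neg_mul,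
    Finset.sum_neg_distrib, mul_assoc (lam * _), ← Finset.mul_sum] at hx
  simp only [Pi.sub_apply, Pi.smul_apply, Finset.sum_apply, smul_eq_mul]
  linear_combination hx

lemma IsSobolevOP.connection (hγ : 0 < γ) (hμ0 : 0 < μ) (hμ1 : μ < 1) (hlam : 0 < lam) {n : ℕ}
    {Q : ℝ[X]} (hQ : IsSobolevOP γ μ lam α i j (n + 1) Q) {x : ℝ}
    (hbr : br i (x - α) (j + 1) ≠ 0) :
    Q.eval x = A1 γ μ lam α i j (n + 1) x * MeixnerM γ μ (n + 1) x +
      B1 γ μ lam α i j (n + 1) x * MeixnerM γ μ n x := by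
  have hK := (one_add_mul_Klm_pos (i := i) (j := j) (α := α) hγ hμ0 hμ1 hlam n).ne'
  have hN := (nrm2_pos hγ hμ0 hμ1 n).ne'
  have hQe := hQ.eval_eq hγ hμ0 hμ1
  have hDQ : Dk i j (fun t => Q.eval t) α * (1 + lam * Klm γ μ i j j n α α) =
      Dk i j (MeixnerM γ μ (n + 1)) α := by
    have h := congrFun (congrArg (Dk i j) hQe) α
    rw [Dk_sub, Dk_smul, Dk_sum_smul] at h
    simp only [Pi.sub_apply, Pi.smul_apply, Finset.sum_apply, smul_eq_mul] at h
    have hs : ∑ k ∈ Finset.range (n + 1), Dk i j (MeixnerM γ μ k) α / nrm2 γ μ k *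
        Dk i j (MeixnerM γ μ k) α = Klm γ μ i j j n α α :=
      Finset.sum_congr rfl fun k _ => by ring
    rw [hs] at h
    linear_combination h
  set g : ℝ → ℝ := ∑ k ∈ Finset.range (n + 1), (MeixnerM γ μ k x / nrm2 γ μ k) • MeixnerM γ μ k
    with hg
  have hF : (fun t => (x - t) * g t) = (MeixnerM γ μ (n + 1) x / nrm2 γ μ n) • MeixnerM γ μ n -
      (MeixnerM γ μ n x / nrm2 γ μ n) • MeixnerM γ μ (n + 1) := by
    funext t
    simp only [hg, Finset.sum_apply, Pi.smul_apply, Pi.sub_apply, smul_eq_mul]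
    rw [christoffel_darboux hγ hμ0 hμ1]
    ring
  have hT := sum_Dk_sub_mul i j x α g
  have hQx : Q.eval x = MeixnerM γ μ (n + 1) x -
      lam * Dk i j (fun t => Q.eval t) α * Dk i j g α := by
    refine (congrFun hQe x).trans ?_
    rw [hg, Dk_sum_smul]
    simp only [Pi.sub_apply, Pi.smul_apply, Finset.sum_apply, smul_eq_mul]
    congr 2
    exact Finset.sum_congr rfl fun k _ => by ring
  have hsum : (∑ k ∈ Finset.range (j + 1), acoef γ μ lam α i j (n + 1) k * br i (x - α) k) *
        MeixnerM γ μ (n + 1) x +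
      (∑ k ∈ Finset.range (j + 1), bcoef γ μ lam α i j (n + 1) k * br i (x - α) k) *
        MeixnerM γ μ n x =
      -(lam * Dk i j (fun t => Q.eval t) α) * (br i (x - α) (j + 1) * Dk i j g α) := by
    rw [show br i (x - α) (j + 1) * Dk i j g α =
      j.factorial * (br i (x - α) (j + 1) * Dk i j g α / j.factorial) by field_simp, ← hT, hF,
      Finset.mul_sum, Finset.mul_sum, Finset.sum_mul, Finset.sum_mul, ← Finset.sum_add_distrib]
    refine Finset.sum_congr rfl fun k _ => ?_
    rw [Dk_sub, Dk_smul, Dk_smul, acoef, bcoef, ← hDQ]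
    simp only [Pi.sub_apply, Pi.smul_apply, smul_eq_mul, Nat.add_sub_cancel]
    field_simp
    ring
  rw [hQx, A1, B1]
  field_simp
  linear_combination -hsum

end Sobolev

/-- `(x + γδ_{i,1}) 𝒟_i Q_n^{(i)}(x) = C_{1,n}(x) M_n(x) + D_{1,n}(x) M_{n−1}(x)`. -/
theorem sobolev_structure_relation_n (γ μ lam α : ℝ) (hγ : 0 < γ) (hμ0 : 0 < μ)
    (hμ1 : μ < 1) (hlam : 0 < lam) (hα : α ≤ 0) (j i n : ℕ) (hi : i = 1 ∨ i = 2)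
    (hn : 2 ≤ n) (Q : Polynomial ℝ) (hQ : IsSobolevOP γ μ lam α i j n Q) (x : ℝ)
    (hbr : br i (x - α) (j + 1) ≠ 0) (hbr' : br i (sh i x - α) (j + 1) ≠ 0) :
    (x + γ * kdelta i 1) * Dop i (fun t => Q.eval t) x =
      C1 γ μ lam α i j n x * MeixnerM γ μ n x +
        D1 γ μ lam α i j n x * MeixnerM γ μ (n - 1) x := by
  obtain ⟨n, rfl⟩ : ∃ m, n = m + 2 := ⟨n - 2, by omega⟩
  have hQx := hQ.connection hγ hμ0 hμ1 hlam hbr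
  have hQs := hQ.connection hγ hμ0 hμ1 hlam hbr'
  have hβ := (betaR_succ_pos hγ hμ0 hμ1 n).ne'
  have hr : MeixnerM γ μ n x = (x * MeixnerM γ μ (n + 1) x - MeixnerM γ μ (n + 2) x -
      alphaR γ μ (n + 1) * MeixnerM γ μ (n + 1) x) / betaR γ μ (n + 1) := by
    have h := MeixnerM_recurrence hγ hμ0 hμ1 (n + 1) x
    rw [Nat.add_sub_cancel] at h
    rw [eq_div_iff hβ]
    linear_combination -h
  simp only [C1, D1, show n + 2 - 1 = n + 1 from rfl, div_mul_eq_div_div]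
  rcases hi with rfl | rfl
  · have h1 := MeixnerM_forward hγ hμ0 hμ1 (n + 2) x
    have h2 := MeixnerM_forward hγ hμ0 hμ1 (n + 1) x
    simp only [show n + 2 - 1 = n + 1 from rfl, Nat.add_sub_cancel, hr] at h1 h2
    simp only [sh, Dop, kdelta, if_true, if_false, show (1 : ℕ) ≠ 2 by decide, Real.rpow_zero,
      mul_one] at hQs ⊢
    rw [hQx, hQs]
    push_cast at h1 h2 ⊢
    linear_combination A1 γ μ lam α 1 j (n + 2) (x + 1) * h1 +
      B1 γ μ lam α 1 j (n + 2) (x + 1) * h2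
  · have h1 := MeixnerM_backward (γ := γ) hμ0 hμ1 (n + 2) x
    have h2 := MeixnerM_backward (γ := γ) hμ0 hμ1 (n + 1) x
    simp only [show n + 2 - 1 = n + 1 from rfl, Nat.add_sub_cancel, hr] at h1 h2
    simp only [sh, Dop, kdelta, if_true, if_false, show (2 : ℕ) ≠ 1 by decide, Real.rpow_one,
      mul_zero, add_zero] at hQs ⊢
    rw [hQx, hQs]
    push_cast at h1 h2 ⊢
    linear_combination A1 γ μ lam α 2 j (n + 2) (x - 1) * h1 +
      B1 γ μ lam α 2 j (n + 2) (x - 1) * h2
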